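/- For every integer q ≥ 2, the function g_q : [q+1, ∞) → ℝ defined by g_q(N) := 1 + (√q·θ_q(N) − 1)·N / (q − 2√q·θ_q(N) + 1) is strictly increasing (in particular q − 2√q·θ_q(N) + 1 > 0 for all N ≥ q+1). -/

import Mathlib

open Real Set

/-- For an integer `m ≥ 2`, the function
`F_m(φ) = -cos((m+1)φ/2) / cos((m-1)φ/2)`. -/
noncomputable def Fm (m : ℕ) (φ : ℝ) : ℝ :=
  -Real.cos (((m : ℝ) + 1) * φ / 2) / Real.cos (((m : ℝ) - 1) * φ / 2)

/-- The quantity `u(N) = ((q^{(m+1)/2} − q^{(m−1)/2})/(N − 1 − q^{(m−1)/2}) − 1)/√q`. -/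
noncomputable def uN (q m : ℕ) (N : ℝ) : ℝ :=
  (((q : ℝ) ^ (((m : ℝ) + 1) / 2) - (q : ℝ) ^ (((m : ℝ) - 1) / 2)) /
      (N - 1 - (q : ℝ) ^ (((m : ℝ) - 1) / 2)) - 1) / Real.sqrt q

/-- `θ` is the function `θ_q`: for every real `N ≥ q+1`, whenever `m ≥ 2` is the integer
with `q^{m/2} ≤ N−1 < q^{(m+1)/2}` and `φ ∈ [π/(m+1), π/m]` satisfies `F_m(φ) = u(N)`,
then `θ(N) = cos φ`. -/
def IsTheta (q : ℕ) (θ : ℝ → ℝ) : Prop :=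
  ∀ N : ℝ, (q : ℝ) + 1 ≤ N → ∀ m : ℕ, 2 ≤ m →
    (q : ℝ) ^ ((m : ℝ) / 2) ≤ N - 1 → N - 1 < (q : ℝ) ^ (((m : ℝ) + 1) / 2) →
    ∀ φ ∈ Set.Icc (π / ((m : ℝ) + 1)) (π / (m : ℝ)),
      Fm m φ = uN q m N → θ N = Real.cos φ

/-- The value `1 + (s c - 1) N / (s² - 2 s c + 1)`, with `s = √q` and `c = cos φ`. -/
noncomputable def genusBound (s c N : ℝ) : ℝ :=
  1 + (s * c - 1) * N / (s ^ 2 - 2 * s * c + 1)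

lemma genusBound_den_pos {s c : ℝ} (hs : 1 < s) (hc : c ≤ 1) :
    0 < s ^ 2 - 2 * s * c + 1 := by
  nlinarith [mul_nonneg (by linarith : (0 : ℝ) ≤ s) (sub_nonneg.2 hc), sq_pos_of_pos (sub_pos.2 hs)]

lemma genusBound_lt {s c c' N N' : ℝ} (hs : 1 < s) (hc' : c' ≤ 1) (hcc : c < c')
    (hsc : 1 ≤ s * c) (hN : 0 < N) (hNN : N ≤ N') :
    genusBound s c N < genusBound s c' N' := by
  have h1 := genusBound_den_pos hs (hcc.le.trans hc')
  have h2 := genusBound_den_pos hs hc'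
  have h3 : (s * c - 1) * N ≤ (s * c - 1) * N' :=
    mul_le_mul_of_nonneg_left hNN (by linarith)
  have h4 : (s * c - 1) * N' < (s * c' - 1) * N' :=
    mul_lt_mul_of_pos_right (by nlinarith) (by linarith)
  have h5 : s ^ 2 - 2 * s * c' + 1 ≤ s ^ 2 - 2 * s * c + 1 := by nlinarith
  have h6 : 0 ≤ (s * c - 1) * N := mul_nonneg (by linarith) hN.le
  unfold genusBound
  have h7 := div_lt_div₀ (h3.trans_lt h4) h5 (by linarith) h2
  linarith

lemma Fm_denom_pos {m : ℕ} (hm : 2 ≤ m) {φ : ℝ}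
    (hφ : φ ∈ Icc (π / ((m : ℝ) + 1)) (π / (m : ℝ))) :
    0 < Real.cos (((m : ℝ) - 1) * φ / 2) := by
  have hm' : (2 : ℝ) ≤ m := by exact_mod_cast hm
  have h1 : φ * m ≤ π := (le_div_iff₀ (by linarith)).1 hφ.2
  have h0 : 0 < φ := lt_of_lt_of_le (by positivity) hφ.1
  apply Real.cos_pos_of_mem_Ioo
  constructor <;> nlinarith [Real.pi_pos]

lemma Fm_continuousOn {m : ℕ} (hm : 2 ≤ m) :
    ContinuousOn (Fm m) (Icc (π / ((m : ℝ) + 1)) (π / (m : ℝ))) := by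
  unfold Fm
  refine ContinuousOn.div (by fun_prop) (by fun_prop) fun φ hφ => (Fm_denom_pos hm hφ).ne'

lemma Fm_left (m : ℕ) : Fm m (π / ((m : ℝ) + 1)) = 0 := by
  have h : ((m : ℝ) + 1) * (π / ((m : ℝ) + 1)) / 2 = π / 2 := by field_simp
  simp [Fm, h]

lemma Fm_right {m : ℕ} (hm : 2 ≤ m) : Fm m (π / (m : ℝ)) = 1 := by
  have hm' : (2 : ℝ) ≤ m := by exact_mod_cast hm
  have hle : π / ((m : ℝ) + 1) ≤ π / m := by gcongr; linarith
  have hd := Fm_denom_pos hm (right_mem_Icc.2 hle)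
  have h1 : ((m : ℝ) + 1) * (π / m) / 2 = π / (2 * m) + π / 2 := by field_simp; ring
  have h2 : ((m : ℝ) - 1) * (π / m) / 2 = π / 2 - π / (2 * m) := by field_simp
  unfold Fm
  rw [h2] at hd ⊢
  rw [h1, Real.cos_add_pi_div_two, neg_neg]
  rw [Real.cos_pi_div_two_sub] at hd ⊢
  exact div_self hd.ne'

lemma Fm_monotoneOn {m : ℕ} (hm : 2 ≤ m) :
    MonotoneOn (Fm m) (Icc (π / ((m : ℝ) + 1)) (π / (m : ℝ))) := by
  intro x hx y hy hxy
  have hm' : (2 : ℝ) ≤ m := by exact_mod_cast hm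
  have hx1 : π ≤ x * (m + 1) := (div_le_iff₀ (by linarith)).1 hx.1
  have hy1 : y * m ≤ π := (le_div_iff₀ (by linarith)).1 hy.2
  have h0 : 0 < x := lt_of_lt_of_le (by positivity) hx.1
  have hπ := Real.pi_pos
  have hy3 : y ≤ π / 2 := by nlinarith
  have hnum : Real.cos (((m : ℝ) + 1) * y / 2) ≤ Real.cos (((m : ℝ) + 1) * x / 2) :=
    Real.cos_le_cos_of_nonneg_of_le_pi (by positivity) (by nlinarith) (by gcongr)
  have hnum0 : Real.cos (((m : ℝ) + 1) * y / 2) ≤ 0 :=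
    Real.cos_nonpos_of_pi_div_two_le_of_le (by nlinarith) (by nlinarith)
  have hden : Real.cos (((m : ℝ) - 1) * y / 2) ≤ Real.cos (((m : ℝ) - 1) * x / 2) :=
    Real.cos_le_cos_of_nonneg_of_le_pi (by nlinarith) (by nlinarith) (by nlinarith)
  exact div_le_div₀ (neg_nonneg.2 hnum0) (neg_le_neg hnum) (Fm_denom_pos hm hy) hden

lemma Fm_two {φ : ℝ} (h : 0 < Real.cos (φ / 2)) : Fm 2 φ = 1 - 2 * Real.cos φ := by
  have h1 : Real.cos (((2 : ℕ) + 1 : ℝ) * φ / 2)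
      = 4 * Real.cos (φ / 2) ^ 3 - 3 * Real.cos (φ / 2) := by
    rw [← Real.cos_three_mul]; congr 1; push_cast; ring
  have h2 : Real.cos φ = 2 * Real.cos (φ / 2) ^ 2 - 1 := by
    rw [← Real.cos_two_mul]; congr 1; ring
  have h3 : Real.cos (((2 : ℕ) - 1 : ℝ) * φ / 2) = Real.cos (φ / 2) := by
    congr 1; push_cast; ring
  unfold Fm
  rw [h1, h3, h2]
  field_simp
  ring

lemma Fm_three (φ : ℝ) : Fm 3 φ = (1 - 2 * Real.cos φ ^ 2) / Real.cos φ := by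
  have h1 : Real.cos (((3 : ℕ) + 1 : ℝ) * φ / 2) = 2 * Real.cos φ ^ 2 - 1 := by
    rw [← Real.cos_two_mul]; congr 1; push_cast; ring
  have h3 : Real.cos (((3 : ℕ) - 1 : ℝ) * φ / 2) = Real.cos φ := by
    congr 1; push_cast; ring
  unfold Fm
  rw [h1, h3]
  ring

lemma den_three_pos {c : ℝ} (hs : 1 < s) (hc : 1 / 2 ≤ c) (hc' : c ^ 2 ≤ 1 / 2) :
    0 < c + s - 2 * s * c ^ 2 := by nlinarith

lemma three_formula_lt {c c' : ℝ} (hs : 1 < s) (hc : 0 < c) (hcc : c < c')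
    (hQ : 0 < c + s - 2 * s * c ^ 2) (hQ' : 0 < c' + s - 2 * s * c' ^ 2) :
    s * (s ^ 2 - 1) * c ^ 2 / (c + s - 2 * s * c ^ 2) <
      s * (s ^ 2 - 1) * c' ^ 2 / (c' + s - 2 * s * c' ^ 2) := by
  rw [div_lt_div_iff₀ hQ hQ']
  have h1 : 0 < s * (s ^ 2 - 1) := by nlinarith
  have h2 : 0 < (c' - c) * (c * c' + s * (c + c')) := by
    apply mul_pos (by linarith)
    have : 0 < s * (c + c') := mul_pos (by linarith) (by linarith)
    nlinarith
  nlinarith [mul_pos h1 h2]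

/-- `N - 1` lies in `[s ^ m, s ^ (m + 1))` and `φ` is the preimage of `u(N)` under `F_m`. -/
structure IsAngle (s : ℝ) (m : ℕ) (N φ : ℝ) : Prop where
  two_le : 2 ≤ m
  le : s ^ m ≤ N - 1
  lt : N - 1 < s ^ (m + 1)
  mem : φ ∈ Icc (π / ((m : ℝ) + 1)) (π / (m : ℝ))
  eq : Fm m φ = (s ^ (m + 1) - (N - 1)) / (s * (N - 1 - s ^ (m - 1)))

namespace IsAngle

variable {s N φ N' φ' : ℝ} {m m' : ℕ}

lemma sub_pos (hs : 1 < s) (h : IsAngle s m N φ) : 0 < N - 1 - s ^ (m - 1) := by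
  have h1 : s ^ (m - 1) < s ^ m := pow_lt_pow_right₀ hs (by have := h.two_le; omega)
  linarith [h.le]

lemma left_lt (hs : 1 < s) (h : IsAngle s m N φ) : π / ((m : ℝ) + 1) < φ := by
  refine lt_of_le_of_ne h.mem.1 fun he => ?_
  have h1 := h.eq
  rw [← he, Fm_left] at h1
  have h2 := h.sub_pos hs
  have h3 : 0 < (s ^ (m + 1) - (N - 1)) / (s * (N - 1 - s ^ (m - 1))) :=
    div_pos (by linarith [h.lt]) (mul_pos (by linarith) h2)
  exact h3.ne h1

lemma le_pi (h : IsAngle s m N φ) : φ ≤ π := by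
  have hm : (2 : ℝ) ≤ m := by exact_mod_cast h.two_le
  exact h.mem.2.trans (div_le_self Real.pi_pos.le (by linarith))

lemma nonneg (h : IsAngle s m N φ) : 0 ≤ φ := le_trans (by positivity) h.mem.1

lemma cos_lt (hs : 1 < s) (h : IsAngle s m N φ) : Real.cos φ < Real.cos (π / ((m : ℝ) + 1)) :=
  Real.cos_lt_cos_of_nonneg_of_le_pi (by positivity) h.le_pi (h.left_lt hs)

lemma le_cos (h : IsAngle s m N φ) {k : ℕ} (hk : 1 ≤ k) (hkm : k ≤ m) :
    Real.cos (π / (k : ℝ)) ≤ Real.cos φ := by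
  have hk' : (1 : ℝ) ≤ k := by exact_mod_cast hk
  refine Real.cos_le_cos_of_nonneg_of_le_pi h.nonneg
    (div_le_self Real.pi_pos.le hk') (h.mem.2.trans ?_)
  gcongr

lemma cos_lt_cos_of_lt (hs : 1 < s) (h : IsAngle s m N φ) (h' : IsAngle s m N' φ')
    (hN : N < N') : Real.cos φ < Real.cos φ' := by
  refine Real.cos_lt_cos_of_nonneg_of_le_pi h'.nonneg h.le_pi ?_
  by_contra! hle
  have h1 := Fm_monotoneOn h.two_le h.mem h'.mem hle
  rw [h.eq, h'.eq] at h1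
  have h2 := h.sub_pos hs
  have h3 : (s ^ (m + 1) - (N' - 1)) / (s * (N' - 1 - s ^ (m - 1)))
      < (s ^ (m + 1) - (N - 1)) / (s * (N - 1 - s ^ (m - 1))) :=
    div_lt_div₀ (by linarith) (mul_le_mul_of_nonneg_left (by linarith) (by linarith))
      (by linarith [h.lt]) (mul_pos (by linarith) h2)
  linarith

lemma index_le (hs : 1 < s) (h : IsAngle s m N φ) (h' : IsAngle s m' N' φ') (hN : N < N') :
    m ≤ m' := by
  by_contra! hlt
  have h1 : s ^ (m' + 1) ≤ s ^ m := pow_le_pow_right₀ hs.le hlt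
  linarith [h.le, h'.lt]

lemma genusBound_eq_of_two (hs : 1 < s) (h : IsAngle s 2 N φ) :
    genusBound s (Real.cos φ) N = (N - 1 - s ^ 2) / (2 * s) := by
  have h0 := h.sub_pos hs
  have hd := Fm_denom_pos h.two_le h.mem
  have he := h.eq
  rw [Fm_two (by convert hd using 2; push_cast; ring)] at he
  norm_num at h0 he
  have hc : Real.cos φ = (s + 1) * (N - 1 - s ^ 2) / (2 * s * (N - 1 - s)) := by
    have : Real.cos φ = (1 - (s ^ 3 - (N - 1)) / (s * (N - 1 - s))) / 2 := by linarith
    rw [this]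
    have : N - 1 - s ≠ 0 := by linarith
    field_simp
    ring
  have hN : 0 < N := by linarith
  have hs1 : 0 < s - 1 := by linarith
  have hden : s ^ 2 - 2 * s * Real.cos φ + 1 = s * (s - 1) * N / (N - 1 - s) := by
    rw [hc]
    have : N - 1 - s ≠ 0 := by linarith
    field_simp
    ring
  have hnum : s * Real.cos φ - 1 = (s - 1) * (N - 1 - s * (s + 2)) / (2 * (N - 1 - s)) := by
    rw [hc]
    have : N - 1 - s ≠ 0 := by linarith
    field_simp
    ring
  unfold genusBound
  rw [hden, hnum]
  have : N - 1 - s ≠ 0 := by linarith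
  field_simp
  ring

lemma half_le_cos (h : IsAngle s 3 N φ) : 1 / 2 ≤ Real.cos φ := by
  have := h.le_cos (k := 3) (by norm_num) le_rfl
  simpa [Real.cos_pi_div_three] using this

lemma cos_lt_sqrt_two_div_two (hs : 1 < s) (h : IsAngle s 3 N φ) :
    Real.cos φ < √2 / 2 := by
  have := h.cos_lt hs
  norm_num at this
  exact this

lemma cos_sq_le (hs : 1 < s) (h : IsAngle s 3 N φ) : Real.cos φ ^ 2 ≤ 1 / 2 := by
  have h1 := h.cos_lt_sqrt_two_div_two hs
  have h2 := h.half_le_cos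
  nlinarith [Real.sq_sqrt (show (0 : ℝ) ≤ 2 by norm_num)]

lemma genusBound_eq_of_three (hs : 1 < s) (h : IsAngle s 3 N φ) :
    genusBound s (Real.cos φ) N = s * (s ^ 2 - 1) * Real.cos φ ^ 2 /
      (Real.cos φ + s - 2 * s * Real.cos φ ^ 2) := by
  have h0 := h.sub_pos hs
  have he := h.eq
  have hc := h.half_le_cos
  have hQ := den_three_pos hs hc (h.cos_sq_le hs)
  have hD := genusBound_den_pos hs (Real.cos_le_one φ)
  rw [Fm_three] at he
  norm_num at h0 he
  set c := Real.cos φ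
  rw [div_eq_div_iff (by linarith) (mul_pos (by linarith) (by linarith)).ne'] at he
  have hN : N = (s ^ 2 - 2 * s * c + 1) * ((s ^ 2 + 1) * c + s) / (c + s - 2 * s * c ^ 2) := by
    rw [eq_div_iff hQ.ne']
    linear_combination he
  unfold genusBound
  rw [hN, mul_div_assoc', mul_left_comm, div_right_comm, mul_div_cancel_left₀ _ hD.ne',
    one_add_div hQ.ne']
  congr 1
  ring

lemma one_le_mul_cos (hs : 1 < s) (hs2 : 2 ≤ s ^ 2) (h : IsAngle s m N φ) (hm : 4 ≤ m) :
    1 ≤ s * (√2 / 2) ∧ √2 / 2 ≤ Real.cos φ := by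
  have h1 := h.le_cos (k := 4) (by norm_num) hm
  norm_num at h1
  refine ⟨?_, h1⟩
  have h2 : √2 ≤ s := Real.sqrt_le_iff.2 ⟨by linarith, hs2⟩
  nlinarith [Real.sq_sqrt (show (0 : ℝ) ≤ 2 by norm_num), Real.sqrt_nonneg 2]

lemma genusBound_two_lt (hs : 1 < s) (h : IsAngle s 2 N φ) :
    genusBound s (Real.cos φ) N < s * (s - 1) / 2 := by
  rw [h.genusBound_eq_of_two hs, div_lt_iff₀ (by linarith)]
  have := h.lt
  norm_num at this
  linarith

lemma le_genusBound_three (hs : 1 < s) (h : IsAngle s 3 N φ) :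
    s * (s - 1) / 2 ≤ genusBound s (Real.cos φ) N := by
  rw [h.genusBound_eq_of_three hs]
  have hc := h.half_le_cos
  have hv : s * (s - 1) / 2 =
      s * (s ^ 2 - 1) * (1 / 2) ^ 2 / (1 / 2 + s - 2 * s * (1 / 2) ^ 2) := by
    have : 1 / 2 + s - 2 * s * (1 / 2) ^ 2 = (1 + s) / 2 := by ring
    rw [this]
    have : 1 + s ≠ 0 := by linarith
    field_simp
    ring
  rw [hv]
  rcases hc.eq_or_lt with he | hlt
  · rw [← he]
  · exact (three_formula_lt hs (by norm_num) hlt (den_three_pos hs le_rfl (by norm_num))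
      (den_three_pos hs hc (h.cos_sq_le hs))).le

lemma genusBound_three_lt (hs : 1 < s) (h : IsAngle s 3 N φ) :
    genusBound s (Real.cos φ) N < s * (s ^ 2 - 1) / √2 := by
  rw [h.genusBound_eq_of_three hs]
  have hc := h.half_le_cos
  have h2 := Real.sq_sqrt (show (0 : ℝ) ≤ 2 by norm_num)
  have hr : 0 < √2 := by positivity
  have hden : √2 / 2 + s - 2 * s * (√2 / 2) ^ 2 = √2 / 2 := by rw [div_pow, h2]; ring
  have := three_formula_lt hs (by linarith) (h.cos_lt_sqrt_two_div_two hs)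
    (den_three_pos hs hc (h.cos_sq_le hs)) (by rw [hden]; positivity)
  rw [hden] at this
  refine this.trans_eq ?_
  rw [div_pow, h2]
  field_simp

lemma le_genusBound_of_four_le (hs : 1 < s) (hs2 : 2 ≤ s ^ 2) (h : IsAngle s m N φ)
    (hm : 4 ≤ m) : s * (s ^ 2 - 1) / √2 ≤ genusBound s (Real.cos φ) N := by
  obtain ⟨h1, h2⟩ := h.one_le_mul_cos hs hs2 hm
  have hr2 := Real.sq_sqrt (show (0 : ℝ) ≤ 2 by norm_num)
  have hr : 0 < √2 := by positivity
  have hr1 : √2 / 2 ≤ 1 := h2.trans (Real.cos_le_one φ)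
  have hN : s ^ 4 + 1 ≤ N := by
    have : s ^ 4 ≤ s ^ m := pow_le_pow_right₀ hs.le hm
    linarith [h.le]
  have hD := genusBound_den_pos hs hr1
  have hD' := genusBound_den_pos hs (Real.cos_le_one φ)
  have hs4 : 0 < s ^ 4 := by positivity
  have hv : s * (s ^ 2 - 1) / √2 = genusBound s (√2 / 2) (s ^ 4 + 1) := by
    have hf : s ^ 4 + 1 = (s ^ 2 - 2 * s * (√2 / 2) + 1) * (s ^ 2 + √2 * s + 1) := by
      linear_combination s ^ 2 * hr2
    unfold genusBound
    rw [hf, mul_left_comm, mul_div_cancel_left₀ _ hD.ne', div_eq_iff hr.ne']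
    linear_combination (-s ^ 3 / 2 - s ^ 2 * √2 / 2 + s / 2) * hr2
  rw [hv]
  have hsc : s * (√2 / 2) ≤ s * Real.cos φ := mul_le_mul_of_nonneg_left h2 (by linarith)
  have hnum : (s * (√2 / 2) - 1) * (s ^ 4 + 1) ≤ (s * Real.cos φ - 1) * N :=
    mul_le_mul (by linarith) hN (by linarith) (by linarith)
  have hnum0 : 0 ≤ (s * (√2 / 2) - 1) * (s ^ 4 + 1) := mul_nonneg (by linarith) (by linarith)
  have hden : s ^ 2 - 2 * s * Real.cos φ + 1 ≤ s ^ 2 - 2 * s * (√2 / 2) + 1 := by linarith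
  have := div_le_div₀ (hnum0.trans hnum) hnum hD' hden
  unfold genusBound
  linarith

lemma genusBound_lt_of_lt (hs : 1 < s) (hs2 : 2 ≤ s ^ 2) (h : IsAngle s m N φ)
    (h' : IsAngle s m' N' φ') (hN : N < N') :
    genusBound s (Real.cos φ) N < genusBound s (Real.cos φ') N' := by
  have hmm := h.index_le hs h' hN
  have hm2 := h.two_le
  have hNpos : 0 < N := by
    have : 0 < s ^ m := by positivity
    linarith [h.le]
  have hmid : s * (s - 1) / 2 ≤ s * (s ^ 2 - 1) / √2 := by
    have hr : √2 ≤ 2 := Real.sqrt_le_iff.2 (by norm_num)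
    have h1 : s * (s - 1) ≤ s * (s ^ 2 - 1) := by nlinarith
    have h2 : 0 ≤ s * (s - 1) := by nlinarith
    exact div_le_div₀ (h2.trans h1) h1 (by positivity) hr
  obtain rfl | rfl | hm4 : m = 2 ∨ m = 3 ∨ 4 ≤ m := by omega
  · obtain rfl | rfl | hm4' : m' = 2 ∨ m' = 3 ∨ 4 ≤ m' := by omega
    · rw [h.genusBound_eq_of_two hs, h'.genusBound_eq_of_two hs]
      gcongr
    · exact (h.genusBound_two_lt hs).trans_le (h'.le_genusBound_three hs)
    · exact (h.genusBound_two_lt hs).trans_le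
        (hmid.trans (h'.le_genusBound_of_four_le hs hs2 hm4'))
  · obtain rfl | hm4' : m' = 3 ∨ 4 ≤ m' := by omega
    · rw [h.genusBound_eq_of_three hs, h'.genusBound_eq_of_three hs]
      exact three_formula_lt hs (by linarith [h.half_le_cos]) (h.cos_lt_cos_of_lt hs h' hN)
        (den_three_pos hs h.half_le_cos (h.cos_sq_le hs))
        (den_three_pos hs h'.half_le_cos (h'.cos_sq_le hs))
    · exact (h.genusBound_three_lt hs).trans_le (h'.le_genusBound_of_four_le hs hs2 hm4')
  · have hcos : Real.cos φ < Real.cos φ' := by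
      rcases hmm.eq_or_lt with rfl | hlt
      · exact h.cos_lt_cos_of_lt hs h' hN
      · refine (h.cos_lt hs).trans_le ?_
        have := h'.le_cos (k := m + 1) (by omega) hlt
        push_cast at this
        exact this
    obtain ⟨h1, h2⟩ := h.one_le_mul_cos hs hs2 hm4
    exact genusBound_lt hs (Real.cos_le_one φ') hcos
      (h1.trans (mul_le_mul_of_nonneg_left h2 (by linarith))) hNpos hN.le

end IsAngle

lemma natCast_rpow_half (q k : ℕ) : (q : ℝ) ^ ((k : ℝ) / 2) = √(q : ℝ) ^ k := by
  rw [Real.sqrt_eq_rpow, ← Real.rpow_natCast, ← Real.rpow_mul (Nat.cast_nonneg q)]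
  congr 1
  ring

lemma uN_eq {q m : ℕ} {N : ℝ} (hm : 2 ≤ m)
    (h : 0 < N - 1 - √(q : ℝ) ^ (m - 1)) :
    uN q m N = (√(q : ℝ) ^ (m + 1) - (N - 1)) / (√(q : ℝ) * (N - 1 - √(q : ℝ) ^ (m - 1))) := by
  have h1 := natCast_rpow_half q (m + 1)
  have h2 := natCast_rpow_half q (m - 1)
  rw [Nat.cast_sub (by omega)] at h2
  push_cast at h1 h2
  unfold uN
  rw [h1, h2, div_sub_one h.ne', div_div, mul_comm (√(q : ℝ))]
  congr 1
  ring

lemma IsTheta.exists_isAngle {q : ℕ} (hq : 2 ≤ q) {θ : ℝ → ℝ} (hθ : IsTheta q θ) {N : ℝ}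
    (hN : (q : ℝ) + 1 ≤ N) : ∃ m φ, IsAngle (√(q : ℝ)) m N φ ∧ θ N = Real.cos φ := by
  have hq' : (2 : ℝ) ≤ q := by exact_mod_cast hq
  have hs : 1 < √(q : ℝ) := Real.lt_sqrt_of_sq_lt (by linarith)
  have hs2 : √(q : ℝ) ^ 2 = q := Real.sq_sqrt (by linarith)
  obtain ⟨m, hm1, hm2⟩ := exists_nat_pow_near (show 1 ≤ N - 1 by linarith) hs
  have hm : 2 ≤ m := by
    have : √(q : ℝ) ^ 2 < √(q : ℝ) ^ (m + 1) := by linarith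
    have := (pow_lt_pow_iff_right₀ hs).1 this
    omega
  have hm' : (2 : ℝ) ≤ m := by exact_mod_cast hm
  have hpos : 0 < N - 1 - √(q : ℝ) ^ (m - 1) := by
    have : √(q : ℝ) ^ (m - 1) < √(q : ℝ) ^ m := pow_lt_pow_right₀ hs (by omega)
    linarith
  have hle : π / ((m : ℝ) + 1) ≤ π / m := by gcongr; linarith
  have hu := uN_eq hm hpos
  have hmem : uN q m N ∈ Icc (Fm m (π / ((m : ℝ) + 1))) (Fm m (π / (m : ℝ))) := by
    rw [Fm_left, Fm_right hm, hu]
    constructor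
    · exact div_nonneg (by linarith) (mul_nonneg (by linarith) hpos.le)
    · rw [div_le_one (mul_pos (by linarith) hpos)]
      have e1 : √(q : ℝ) * √(q : ℝ) ^ (m - 1) = √(q : ℝ) ^ m := mul_pow_sub_one (by omega) _
      rw [pow_succ, mul_sub, e1]
      nlinarith
  obtain ⟨φ, hφ, he⟩ := intermediate_value_Icc hle (Fm_continuousOn hm) hmem
  refine ⟨m, φ, ⟨hm, hm1, hm2, hφ, he.trans hu⟩, hθ N hN m hm ?_ ?_ φ hφ he⟩
  · rwa [natCast_rpow_half]
  · have := natCast_rpow_half q (m + 1)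
    push_cast at this
    rwa [this]

/-- For every integer `q ≥ 2`, the function
`g_q(N) := 1 + (√q·θ_q(N) − 1)·N / (q − 2√q·θ_q(N) + 1)` is strictly increasing on
`[q+1, ∞)`; in particular `q − 2√q·θ_q(N) + 1 > 0` for all `N ≥ q+1`. -/
theorem stmt_2 (q : ℕ) (hq : 2 ≤ q) (θ : ℝ → ℝ) (hθ : IsTheta q θ) :
    (∀ N ∈ Set.Ici ((q : ℝ) + 1), 0 < (q : ℝ) - 2 * Real.sqrt q * θ N + 1) ∧
    StrictMonoOn (fun N : ℝ =>
        1 + (Real.sqrt q * θ N - 1) * N / ((q : ℝ) - 2 * Real.sqrt q * θ N + 1))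
      (Set.Ici ((q : ℝ) + 1)) := by
  have hq' : (2 : ℝ) ≤ q := by exact_mod_cast hq
  have hs : 1 < √(q : ℝ) := Real.lt_sqrt_of_sq_lt (by linarith)
  have hs2 : √(q : ℝ) ^ 2 = q := Real.sq_sqrt (by linarith)
  constructor
  · intro N hN
    obtain ⟨m, φ, -, hc⟩ := hθ.exists_isAngle hq hN
    have := genusBound_den_pos hs (Real.cos_le_one φ)
    rwa [hs2, ← hc] at this
  · intro N hN N' hN' hlt
    obtain ⟨m, φ, h, hc⟩ := hθ.exists_isAngle hq hN
    obtain ⟨m', φ', h', hc'⟩ := hθ.exists_isAngle hq hN'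
    have := h.genusBound_lt_of_lt hs (by rwa [hs2]) h' hlt
    unfold genusBound at this
    rwa [hs2, ← hc, ← hc'] at this
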